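/- Abstract core of the paper's Theorem 4.4 (a priori error estimate). Let Σ_h ⊆ Σ and V_h ⊆ V be linear subspaces with D(Σ_h) ⊆ V_h, and assume the discrete inf-sup hypothesis: there is C_sup > 0 such that for every v ∈ V_h there exists τ ∈ Σ_h with ⟪D τ, v⟫ = ‖v‖² and |||τ||| ≤ C_sup·‖v‖. Then there exists α > 0 depending only on C_sup such that the following holds: if (σ,u) ∈ Σ × V, (σ_h,u_h) ∈ Σ_h × V_h, ε ≥ 0, and E : Σ_h → ℝ satisfy B[(σ_h,u_h),(τ,v)] − B[(σ,u),(τ,v)] = E(τ) for all (τ,v) ∈ Σ_h × V_h, with |E(τ)| ≤ ε·‖τ‖_a for all τ ∈ Σ_h, then for every (π,ρ) ∈ Σ_h × V_h one has N(σ − σ_h, u − u_h) ≤ (1 + 1/α)·N(σ − π, u − ρ) + ε/α. -/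

import Mathlib

open RealInnerProductSpace

/-- The seminorm induced by a positive-semidefinite bilinear form: `‖τ‖_a = √(a(τ,τ))`. -/
noncomputable def aNorm {E : Type*} [NormedAddCommGroup E] [InnerProductSpace ℝ E]
    (a : E →ₗ[ℝ] E →ₗ[ℝ] ℝ) (τ : E) : ℝ := Real.sqrt (a τ τ)

/-- `|||τ|||² = ‖τ‖_a² + ‖D τ‖²`. -/
noncomputable def tNorm {E V : Type*} [NormedAddCommGroup E] [InnerProductSpace ℝ E]
    [NormedAddCommGroup V] [InnerProductSpace ℝ V]
    (a : E →ₗ[ℝ] E →ₗ[ℝ] ℝ) (D : E →ₗ[ℝ] V) (τ : E) : ℝ :=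
  Real.sqrt (aNorm a τ ^ 2 + ‖D τ‖ ^ 2)

/-- `N(τ,v)² = |||τ|||² + ‖v‖²`. -/
noncomputable def NNorm {E V : Type*} [NormedAddCommGroup E] [InnerProductSpace ℝ E]
    [NormedAddCommGroup V] [InnerProductSpace ℝ V]
    (a : E →ₗ[ℝ] E →ₗ[ℝ] ℝ) (D : E →ₗ[ℝ] V) (τ : E) (v : V) : ℝ :=
  Real.sqrt (tNorm a D τ ^ 2 + ‖v‖ ^ 2)

/-- The saddle-point form `B[(σ,u),(τ,v)] = a(σ,τ) − ⟪u, D τ⟫ − ⟪v, D σ⟫`. -/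
noncomputable def BForm {E V : Type*} [NormedAddCommGroup E] [InnerProductSpace ℝ E]
    [NormedAddCommGroup V] [InnerProductSpace ℝ V]
    (a : E →ₗ[ℝ] E →ₗ[ℝ] ℝ) (D : E →ₗ[ℝ] V) (σ : E) (u : V) (τ : E) (v : V) : ℝ :=
  a σ τ - ⟪u, D τ⟫ - ⟪v, D σ⟫

section Helpers

lemma sqrt_add_sq_le_add {x y x₁ y₁ x₂ y₂ : ℝ} (hx0 : 0 ≤ x) (hy0 : 0 ≤ y)
    (hx : x ≤ x₁ + x₂) (hy : y ≤ y₁ + y₂) :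
    Real.sqrt (x ^ 2 + y ^ 2) ≤ Real.sqrt (x₁ ^ 2 + y₁ ^ 2) + Real.sqrt (x₂ ^ 2 + y₂ ^ 2) := by
  have h₁ := Real.sq_sqrt (show 0 ≤ x₁ ^ 2 + y₁ ^ 2 by positivity)
  have h₂ := Real.sq_sqrt (show 0 ≤ x₂ ^ 2 + y₂ ^ 2 by positivity)
  have n₁ := Real.sqrt_nonneg (x₁ ^ 2 + y₁ ^ 2)
  have n₂ := Real.sqrt_nonneg (x₂ ^ 2 + y₂ ^ 2)
  have hcs : x₁ * x₂ + y₁ * y₂ ≤ Real.sqrt (x₁ ^ 2 + y₁ ^ 2) * Real.sqrt (x₂ ^ 2 + y₂ ^ 2) := by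
    refine le_of_abs_le (abs_le_of_sq_le_sq ?_ (by positivity))
    rw [mul_pow, h₁, h₂]
    nlinarith [sq_nonneg (x₁ * y₂ - x₂ * y₁)]
  have hx2 : x ^ 2 ≤ (x₁ + x₂) ^ 2 := by gcongr
  have hy2 : y ^ 2 ≤ (y₁ + y₂) ^ 2 := by gcongr
  exact Real.sqrt_le_iff.2 ⟨by positivity, by nlinarith⟩

variable {E V : Type*} [NormedAddCommGroup E] [InnerProductSpace ℝ E]
  [NormedAddCommGroup V] [InnerProductSpace ℝ V]
  (a : E →ₗ[ℝ] E →ₗ[ℝ] ℝ) (D : E →ₗ[ℝ] V)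

lemma aNorm_nonneg (τ : E) : 0 ≤ aNorm a τ := Real.sqrt_nonneg _

lemma tNorm_nonneg (τ : E) : 0 ≤ tNorm a D τ := Real.sqrt_nonneg _

lemma NNorm_nonneg (τ : E) (v : V) : 0 ≤ NNorm a D τ v := Real.sqrt_nonneg _

lemma tNorm_sq (τ : E) : tNorm a D τ ^ 2 = aNorm a τ ^ 2 + ‖D τ‖ ^ 2 :=
  Real.sq_sqrt (by positivity)

lemma NNorm_sq (τ : E) (v : V) : NNorm a D τ v ^ 2 = tNorm a D τ ^ 2 + ‖v‖ ^ 2 :=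
  Real.sq_sqrt (by positivity)

lemma aNorm_le_tNorm (τ : E) : aNorm a τ ≤ tNorm a D τ :=
  Real.le_sqrt_of_sq_le (by nlinarith [sq_nonneg ‖D τ‖])

lemma norm_apply_le_tNorm (τ : E) : ‖D τ‖ ≤ tNorm a D τ :=
  Real.le_sqrt_of_sq_le (by nlinarith [sq_nonneg (aNorm a τ)])

lemma tNorm_le_NNorm (τ : E) (v : V) : tNorm a D τ ≤ NNorm a D τ v :=
  Real.le_sqrt_of_sq_le (by nlinarith [sq_nonneg ‖v‖])

lemma norm_le_NNorm (τ : E) (v : V) : ‖v‖ ≤ NNorm a D τ v :=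
  Real.le_sqrt_of_sq_le (by nlinarith [sq_nonneg (tNorm a D τ)])

lemma NNorm_le_add (τ : E) (v : V) : NNorm a D τ v ≤ tNorm a D τ + ‖v‖ :=
  Real.sqrt_le_iff.2 ⟨add_nonneg (tNorm_nonneg a D τ) (norm_nonneg v), by
    nlinarith [mul_nonneg (tNorm_nonneg a D τ) (norm_nonneg v)]⟩

lemma aNorm_smul {c : ℝ} (hc : 0 ≤ c) (τ : E) : aNorm a (c • τ) = c * aNorm a τ := by
  simp only [aNorm, map_smul, LinearMap.smul_apply, smul_eq_mul]
  rw [← mul_assoc, Real.sqrt_mul (by positivity), Real.sqrt_mul_self hc]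

lemma tNorm_smul {c : ℝ} (hc : 0 ≤ c) (τ : E) : tNorm a D (c • τ) = c * tNorm a D τ := by
  simp only [tNorm, aNorm_smul a hc, map_smul, norm_smul, Real.norm_of_nonneg hc]
  rw [mul_pow, mul_pow, ← mul_add, Real.sqrt_mul (by positivity), Real.sqrt_sq hc]

variable {a}

lemma aNorm_sq (hp : ∀ τ : E, 0 ≤ a τ τ) (τ : E) : aNorm a τ ^ 2 = a τ τ := Real.sq_sqrt (hp τ)

lemma abs_apply_le_aNorm_mul (hs : ∀ σ τ : E, a σ τ = a τ σ) (hp : ∀ τ : E, 0 ≤ a τ τ)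
    (σ τ : E) : |a σ τ| ≤ aNorm a σ * aNorm a τ := by
  apply abs_le_of_sq_le_sq _ (mul_nonneg (aNorm_nonneg a σ) (aNorm_nonneg a τ))
  rw [mul_pow, aNorm_sq hp, aNorm_sq hp]
  have := LinearMap.BilinForm.apply_mul_apply_le_of_forall_zero_le a hp σ τ
  rw [hs τ σ] at this
  nlinarith

lemma aNorm_sub_le (hs : ∀ σ τ : E, a σ τ = a τ σ) (hp : ∀ τ : E, 0 ≤ a τ τ)
    (σ τ : E) : aNorm a (σ - τ) ≤ aNorm a σ + aNorm a τ := by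
  refine Real.sqrt_le_iff.2 ⟨add_nonneg (aNorm_nonneg a σ) (aNorm_nonneg a τ), ?_⟩
  have := neg_abs_le (a σ τ)
  have := abs_apply_le_aNorm_mul hs hp σ τ
  simp only [map_sub, LinearMap.sub_apply]
  rw [hs τ σ]
  nlinarith [aNorm_sq hp σ, aNorm_sq hp τ]

lemma tNorm_sub_le (hs : ∀ σ τ : E, a σ τ = a τ σ) (hp : ∀ τ : E, 0 ≤ a τ τ)
    (σ τ : E) : tNorm a D (σ - τ) ≤ tNorm a D σ + tNorm a D τ :=
  sqrt_add_sq_le_add (aNorm_nonneg a _) (norm_nonneg _) (aNorm_sub_le hs hp σ τ)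
    (by rw [map_sub]; exact norm_sub_le _ _)

lemma NNorm_sub_le (hs : ∀ σ τ : E, a σ τ = a τ σ) (hp : ∀ τ : E, 0 ≤ a τ τ)
    (σ τ : E) (u v : V) :
    NNorm a D (σ - τ) (u - v) ≤ NNorm a D σ u + NNorm a D τ v :=
  sqrt_add_sq_le_add (tNorm_nonneg a D _) (norm_nonneg _) (tNorm_sub_le D hs hp σ τ)
    (norm_sub_le _ _)

lemma BForm_le (hs : ∀ σ τ : E, a σ τ = a τ σ) (hp : ∀ τ : E, 0 ≤ a τ τ)
    (σ : E) (u : V) (τ : E) (v : V) :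
    BForm a D σ u τ v ≤ 3 * (NNorm a D σ u * NNorm a D τ v) := by
  have h₁ := (le_abs_self _).trans (abs_apply_le_aNorm_mul hs hp σ τ)
  have h₂ := neg_le_of_abs_le (abs_real_inner_le_norm u (D τ))
  have h₃ := neg_le_of_abs_le (abs_real_inner_le_norm v (D σ))
  have hσ := tNorm_le_NNorm a D σ u
  have hτ := tNorm_le_NNorm a D τ v
  have k₁ := mul_le_mul ((aNorm_le_tNorm a D σ).trans hσ) ((aNorm_le_tNorm a D τ).trans hτ)
    (aNorm_nonneg a τ) (NNorm_nonneg a D σ u)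
  have k₂ := mul_le_mul (norm_le_NNorm a D σ u) ((norm_apply_le_tNorm a D τ).trans hτ)
    (norm_nonneg _) (NNorm_nonneg a D σ u)
  have k₃ := mul_le_mul (norm_le_NNorm a D τ v) ((norm_apply_le_tNorm a D σ).trans hσ)
    (norm_nonneg _) (NNorm_nonneg a D τ v)
  unfold BForm
  linarith

/-- Inf-sup stability of the saddle-point form: the test pair `(τ, v)` realizes the combined
norm of `(e, w)` up to the factor `δ / 2`, with `δ = 1 / (1 + C²)`. -/
lemma exists_BForm_ge (hs : ∀ σ τ : E, a σ τ = a τ σ) (hp : ∀ τ : E, 0 ≤ a τ τ)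
    {C : ℝ} (hC : 0 < C) {Sh : Submodule ℝ E} {Vh : Submodule ℝ V}
    (hD : ∀ τ ∈ Sh, D τ ∈ Vh)
    (hsup : ∀ v ∈ Vh, ∃ τ ∈ Sh, ⟪D τ, v⟫ = ‖v‖ ^ 2 ∧ tNorm a D τ ≤ C * ‖v‖)
    {e : E} {w : V} (he : e ∈ Sh) (hw : w ∈ Vh) :
    ∃ τ ∈ Sh, ∃ v ∈ Vh, tNorm a D τ ≤ 2 * NNorm a D e w ∧
      NNorm a D τ v ≤ 4 * NNorm a D e w ∧
      1 / (1 + C ^ 2) / 2 * NNorm a D e w ^ 2 ≤ BForm a D e w τ v := by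
  obtain ⟨τ₀, hτ₀, hin, hle⟩ := hsup w hw
  set δ : ℝ := 1 / (1 + C ^ 2) with hδ
  have hδ0 : 0 < δ := by positivity
  have hδ1 : δ * (1 + C ^ 2) = 1 := by rw [hδ]; field_simp
  have hδle : δ ≤ 1 := by nlinarith [mul_pos hδ0 (pow_pos hC 2)]
  have hδC : δ * C ≤ 1 := by nlinarith [mul_nonneg hδ0.le (sq_nonneg (C - 1))]
  have ht := tNorm_le_NNorm a D e w
  have hwN := norm_le_NNorm a D e w
  have hDe := (norm_apply_le_tNorm a D e).trans ht
  have hτ : tNorm a D (e - δ • τ₀) ≤ 2 * NNorm a D e w := by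
    have h := tNorm_sub_le D hs hp e (δ • τ₀)
    rw [tNorm_smul a D hδ0.le] at h
    have h₁ := mul_le_mul_of_nonneg_left hle hδ0.le
    have h₂ := mul_le_mul_of_nonneg_right hδC (norm_nonneg w)
    linarith
  refine ⟨e - δ • τ₀, Sh.sub_mem he (Sh.smul_mem _ hτ₀), -w - D e,
    Vh.sub_mem (Vh.neg_mem hw) (hD e he), hτ, ?_, ?_⟩
  · have h := norm_sub_le (-w) (D e)
    rw [norm_neg] at h
    linarith [NNorm_le_add a D (e - δ • τ₀) (-w - D e)]
  · have hB : BForm a D e w (e - δ • τ₀) (-w - D e) =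
        aNorm a e ^ 2 + ‖D e‖ ^ 2 + δ * ‖w‖ ^ 2 - δ * a e τ₀ := by
      simp only [BForm, map_sub, map_smul, inner_sub_left, inner_sub_right, inner_neg_left,
        inner_smul_right, real_inner_self_eq_norm_sq, aNorm_sq hp, smul_eq_mul]
      rw [real_inner_comm (D τ₀) w, hin]
      ring
    have h₁ := (le_abs_self _).trans (abs_apply_le_aNorm_mul hs hp e τ₀)
    have h₂ := mul_le_mul_of_nonneg_left ((aNorm_le_tNorm a D τ₀).trans hle) (aNorm_nonneg a e)
    have h₃ := mul_le_mul_of_nonneg_left (h₁.trans h₂) hδ0.le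
    have h₄ : δ * ‖w‖ ^ 2 * (δ * C ^ 2) ≤ δ * ‖w‖ ^ 2 :=
      mul_le_of_le_one_right (by positivity) (by linarith)
    have h₅ := sq_nonneg (aNorm a e - δ * C * ‖w‖)
    have h₆ := mul_le_mul_of_nonneg_right hδle (sq_nonneg (aNorm a e))
    have h₇ := mul_le_mul_of_nonneg_right hδle (sq_nonneg ‖D e‖)
    rw [hB, NNorm_sq, tNorm_sq]
    nlinarith [sq_nonneg ‖D e‖]

end Helpers

/-- Abstract core of the paper's Theorem 4.4 (a priori error estimate), with a constant
`α` depending only on `C_sup`. -/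
theorem a_priori_error_estimate (Csup : ℝ) (hCsup : 0 < Csup) :
    ∃ α : ℝ, 0 < α ∧
      ∀ (E V : Type) [NormedAddCommGroup E] [InnerProductSpace ℝ E]
        [NormedAddCommGroup V] [InnerProductSpace ℝ V]
        (a : E →ₗ[ℝ] E →ₗ[ℝ] ℝ),
        (∀ σ τ : E, a σ τ = a τ σ) →
        (∀ τ : E, 0 ≤ a τ τ) →
        ∀ D : E →ₗ[ℝ] V,
        ∀ (Sh : Submodule ℝ E) (Vh : Submodule ℝ V),
        (∀ τ ∈ Sh, D τ ∈ Vh) →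
        -- discrete inf-sup hypothesis
        (∀ v ∈ Vh, ∃ τ ∈ Sh, ⟪D τ, v⟫ = ‖v‖ ^ 2 ∧ tNorm a D τ ≤ Csup * ‖v‖) →
        ∀ (σ : E) (u : V) (σh : E) (uh : V) (ε : ℝ) (Err : E → ℝ),
          σh ∈ Sh → uh ∈ Vh → 0 ≤ ε →
          (∀ τ ∈ Sh, ∀ v ∈ Vh, BForm a D σh uh τ v - BForm a D σ u τ v = Err τ) →
          (∀ τ ∈ Sh, |Err τ| ≤ ε * aNorm a τ) →
          ∀ π ∈ Sh, ∀ ρ ∈ Vh,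
            NNorm a D (σ - σh) (u - uh) ≤
              (1 + 1 / α) * NNorm a D (σ - π) (u - ρ) + ε / α := by
  refine ⟨1 / (1 + Csup ^ 2) / 24, by positivity, ?_⟩
  intro E V _ _ _ _ a hs hp D Sh Vh hD hsup σ u σh uh ε Err hσh huh hε hB hErr π hπ ρ hρ
  obtain ⟨τ, hτ, v, hv, ht, hN, hge⟩ := exists_BForm_ge D hs hp hCsup hD hsup
    (Sh.sub_mem hσh hπ) (Vh.sub_mem huh hρ)
  have htri := NNorm_sub_le D hs hp (σ - π) (σh - π) (u - ρ) (uh - ρ)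
  rw [sub_sub_sub_cancel_right, sub_sub_sub_cancel_right] at htri
  have hX := NNorm_nonneg a D (σh - π) (uh - ρ)
  have hK := NNorm_nonneg a D (σ - π) (u - ρ)
  set X := NNorm a D (σh - π) (uh - ρ)
  set K := NNorm a D (σ - π) (u - ρ)
  set δ : ℝ := 1 / (1 + Csup ^ 2)
  have hδ : 0 < δ := by positivity
  have hsplit : BForm a D (σh - π) (uh - ρ) τ v =
      Err τ + BForm a D (σ - π) (u - ρ) τ v := by
    rw [← hB τ hτ v hv]
    simp only [BForm, map_sub, LinearMap.sub_apply, inner_sub_left, inner_sub_right]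
    ring
  have hcont := BForm_le D hs hp (σ - π) (u - ρ) τ v
  have hKN := mul_le_mul_of_nonneg_left hN hK
  have hErrτ := (le_abs_self _).trans (hErr τ hτ)
  have hετ := mul_le_mul_of_nonneg_left ((aNorm_le_tNorm a D τ).trans ht) hε
  have hX' : δ * X ≤ 24 * K + 24 * ε := by
    rcases hX.eq_or_lt with h | h
    · rw [← h]; linarith
    · refine le_of_mul_le_mul_right ?_ h
      nlinarith [mul_nonneg hε hX]
  have hXle : X ≤ (24 * K + 24 * ε) / δ := (le_div_iff₀' hδ).2 hX'
  calc NNorm a D (σ - σh) (u - uh) ≤ K + (24 * K + 24 * ε) / δ := by linarith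
    _ = (1 + 1 / (δ / 24)) * K + ε / (δ / 24) := by field_simp; ring
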